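/- arXiv:1910.04361 — 4 statements merged into one kernel-verified Lean document; each statement's English description precedes it below -/
import Mathlib

section
/- For every positive integer K there exists a positive integer N₀ such that for every N ≥ N₀, every matroid isomorphic to m(K_N) (where K_N is the complete graph on N vertices) has decomposition-width greater than K. Consequently, any class of matroids containing matroids isomorphic to m(K_N) for arbitrarily large N contains rank-3 matroids of arbitrarily high decomposition-width. -/
open Set

noncomputable def mrank {α : Type*} (M : Matroid α) (X : Set α) : ℕ :=
  sSup {n | ∃ I, I ⊆ X ∧ M.Indep I ∧ I.ncard = n}

noncomputable def connVal {α : Type*} (M : Matroid α) (U : Set α) : ℕ :=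
  mrank M U + mrank M (M.E \ U) - mrank M M.E

def Sim {α : Type*} (M : Matroid α) (U X X' : Set α) : Prop :=
  ∀ Z ⊆ M.E \ U, (M.Indep (X ∪ Z) ↔ M.Indep (X' ∪ Z))

def SimClassesLE {α : Type*} (M : Matroid α) (U : Set α) (k : ℕ) : Prop :=
  ∃ f : Set α → Fin k, ∀ X X' : Set α, X ⊆ U → X' ⊆ U → f X = f X' → Sim M U X X'

structure Decomp {α : Type*} (M : Matroid α) where
  V : Type
  fin : Finite V
  T : SimpleGraph V
  conn : T.Connected
  acyc : T.IsAcyclic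
  deg : ∀ v : V, (T.neighborSet v).ncard = 1 ∨ (T.neighborSet v).ncard = 3
  leafEquiv : M.E ≃ {v : V // (T.neighborSet v).ncard = 1}

def Decomp.Displays {α : Type*} {M : Matroid α} (D : Decomp M) (U : Set α) : Prop :=
  ∃ u v : D.V, D.T.Adj u v ∧
    U = {x | ∃ h : x ∈ M.E, (D.T.deleteEdges {s(u, v)}).Reachable (D.leafEquiv ⟨x, h⟩).1 u}

def bwLE {α : Type*} (M : Matroid α) (k : ℕ) : Prop :=
  ∃ D : Decomp M, ∀ U, D.Displays U → connVal M U + 1 ≤ k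

def dwLE {α : Type*} (M : Matroid α) (k : ℕ) : Prop :=
  ∃ D : Decomp M, ∀ U, D.Displays U → SimClassesLE M U k

def Pigeonhole {α : Type*} (C : Set (Matroid α)) : Prop :=
  ∀ l : ℕ, 0 < l → ∃ ρ : ℕ, ∀ M ∈ C, bwLE M l → dwLE M ρ

/-- The ground type of the matroid m(K_N): vertices plus edges of the complete graph. -/
def KNGround (N : ℕ) : Type := Fin N ⊕ {p : Sym2 (Fin N) // ¬ p.IsDiag}

/-- A "bad triple" {v_i, e_{ij}, v_j}: two vertices together with the edge joining them. -/
def BadTriple (N : ℕ) (S : Set (KNGround N)) : Prop :=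
  ∃ (i j : Fin N) (p : {q : Sym2 (Fin N) // ¬ q.IsDiag}),
    i ≠ j ∧ (p : Sym2 (Fin N)) = s(i, j) ∧
    S = {Sum.inl i, Sum.inr p, Sum.inl j}

/-- `M` is isomorphic to the rank-3 sparse paving matroid m(K_N): there is a bijection from
the ground set of `M` to vertices-plus-edges of K_N under which the independent sets are
exactly the sets of at most 3 elements other than the bad triples. -/
def IsMKN {α : Type*} (N : ℕ) (M : Matroid α) : Prop :=
  ∃ f : α → KNGround N, Set.BijOn f M.E Set.univ ∧
    ∀ X ⊆ M.E, (M.Indep X ↔ (X.ncard ≤ 3 ∧ ¬ BadTriple N (f '' X)))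

namespace SimpleGraph

variable {V : Type*}

/-- The vertices on the side of `u` after deleting the edge `uv`. -/
def edgeSide (T : SimpleGraph V) (u v : V) : Set V :=
  {x | (T.deleteEdges {s(u, v)}).Reachable x u}

theorem mem_edgeSide_self (T : SimpleGraph V) (u v : V) : u ∈ T.edgeSide u v :=
  Reachable.refl u

theorem IsAcyclic.not_reachable_deleteEdges {T : SimpleGraph V} (hT : T.IsAcyclic) {u v : V}
    (huv : T.Adj u v) : ¬ (T.deleteEdges {s(u, v)}).Reachable u v := by
  have h := isAcyclic_iff_forall_adj_isBridge.1 hT huv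
  rw [isBridge_iff] at h
  exact h

theorem IsAcyclic.disjoint_edgeSide {T : SimpleGraph V} (hT : T.IsAcyclic) {u v : V}
    (huv : T.Adj u v) : Disjoint (T.edgeSide u v) (T.edgeSide v u) := by
  rw [Set.disjoint_left]
  intro x hx hx'
  simp only [edgeSide, mem_ofPred_eq, Sym2.eq_swap (a := v)] at hx hx'
  exact hT.not_reachable_deleteEdges huv (hx.symm.trans hx')

theorem Connected.mem_edgeSide_or {T : SimpleGraph V} (hT : T.Connected) (u v x : V) :
    x ∈ T.edgeSide u v ∨ x ∈ T.edgeSide v u := by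
  obtain ⟨p⟩ := hT.preconnected x u
  simp only [edgeSide, mem_ofPred_eq, Sym2.eq_swap (a := v)]
  generalize hw : u = w at p
  induction p with
  | nil => subst hw; exact Or.inl (Reachable.refl _)
  | @cons a b c hab q ih =>
    subst hw
    by_cases he : s(a, b) = s(u, v)
    · rcases Sym2.eq_iff.1 he with ⟨rfl, -⟩ | ⟨rfl, -⟩
      · exact Or.inl (Reachable.refl _)
      · exact Or.inr (Reachable.refl _)
    · have hadj : (T.deleteEdges {s(u, v)}).Adj a b := by simp [hab, he]
      exact (ih rfl).imp hadj.reachable.trans hadj.reachable.trans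

theorem edgeSide_subset_insert_iUnion (T : SimpleGraph V) (u v : V) :
    T.edgeSide v u ⊆ {v} ∪ ⋃ w ∈ T.neighborSet v \ {u}, T.edgeSide w v := by
  classical
  rintro x ⟨p⟩
  have key : ∀ (y : V) (q : (T.deleteEdges {s(v, u)}).Walk v y), q.IsPath →
      y ∈ ({v} ∪ ⋃ w ∈ T.neighborSet v \ {u}, T.edgeSide w v : Set V) := by
    intro y q hq
    cases q with
    | nil => simp
    | @cons _ w _ h r =>
      right
      rw [Walk.cons_isPath_iff] at hq
      rw [deleteEdges_adj] at h
      refine mem_biUnion (x := w) ⟨h.1, ?_⟩ ?_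
      · rintro rfl
        exact h.2 rfl
      · refine Reachable.symm ⟨r.transfer _ fun e he => ?_⟩
        have h1 := r.edges_subset_edgeSet he
        rw [edgeSet_deleteEdges] at h1 ⊢
        refine ⟨h1.1, ?_⟩
        rintro rfl
        exact hq.2 (r.snd_mem_support_of_mem_edges he)
  exact key x p.reverse.toPath.1 p.reverse.toPath.2

theorem IsAcyclic.edgeSide_ssubset {T : SimpleGraph V} (hT : T.IsAcyclic) {u v w : V}
    (hvw : T.Adj v w) (hwu : w ≠ u) : T.edgeSide w v ⊂ T.edgeSide v u := by
  classical
  have hv : v ∉ T.edgeSide w v := fun h =>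
    Set.disjoint_left.1 (hT.disjoint_edgeSide hvw) (T.mem_edgeSide_self v w) h
  refine ⟨?_, fun h => hv (h (T.mem_edgeSide_self v u))⟩
  rintro x ⟨p⟩
  have hp : v ∉ p.support := fun h => hv ⟨p.dropUntil v h⟩
  have hxw : (T.deleteEdges {s(v, u)}).Reachable x w := by
    refine ⟨p.transfer _ fun e he => ?_⟩
    have h1 := p.edges_subset_edgeSet he
    rw [edgeSet_deleteEdges] at h1 ⊢
    refine ⟨h1.1, ?_⟩
    rintro rfl
    exact hp (p.fst_mem_support_of_mem_edges he)
  refine hxw.trans (Adj.reachable ?_)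
  rw [deleteEdges_adj]
  refine ⟨hvw.symm, fun h => ?_⟩
  rcases Sym2.eq_iff.1 h with ⟨rfl, -⟩ | ⟨h, -⟩
  · exact hvw.ne rfl
  · exact hwu h

/-- In a tree of maximum degree at most three, any `3 * K + 2` marked vertices are split by some
edge into two parts of more than `K` vertices each. -/
theorem exists_adj_balanced [Finite V] {T : SimpleGraph V} (hconn : T.Connected)
    (hacyc : T.IsAcyclic) (hdeg : ∀ v, 0 < (T.neighborSet v).ncard ∧ (T.neighborSet v).ncard ≤ 3)
    {W : Set V} {K : ℕ} (hW : 3 * K + 2 ≤ W.ncard) :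
    ∃ u v, T.Adj u v ∧ K < (W ∩ T.edgeSide u v).ncard ∧ K < (W ∩ T.edgeSide v u).ncard := by
  have hsum : ∀ u v, W.ncard ≤ (W ∩ T.edgeSide u v).ncard + (W ∩ T.edgeSide v u).ncard := by
    intro u v
    refine le_trans (ncard_le_ncard (fun x hx => ?_)) (ncard_union_le _ _)
    exact (hconn.mem_edgeSide_or u v x).imp (⟨hx, ·⟩) (⟨hx, ·⟩)
  have main : ∀ n u v, (T.edgeSide v u).ncard = n → T.Adj u v →
      K < (W ∩ T.edgeSide v u).ncard →
      ∃ u v, T.Adj u v ∧ K < (W ∩ T.edgeSide u v).ncard ∧ K < (W ∩ T.edgeSide v u).ncard := by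
    intro n
    induction n using Nat.strong_induction_on with
    | _ n ih =>
      intro u v hn huv hK
      by_cases hw : ∃ w, T.Adj v w ∧ w ≠ u ∧ K < (W ∩ T.edgeSide w v).ncard
      · obtain ⟨w, hvw, hwu, hKw⟩ := hw
        exact ih _ (hn ▸ ncard_lt_ncard (hacyc.edgeSide_ssubset hvw hwu)) v w rfl hvw hKw
      · push Not at hw
        refine ⟨u, v, huv, ?_, hK⟩
        have hfin : (T.neighborSet v \ {u}).Finite := toFinite _
        have hcard : (T.neighborSet v \ {u}).ncard ≤ 2 := by
          have h1 := ncard_sdiff_singleton_add_one (show u ∈ T.neighborSet v from huv.symm)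
          have h2 := (hdeg v).2
          omega
        have hbound : (W ∩ T.edgeSide v u).ncard ≤ 1 + 2 * K := by
          have hsub : W ∩ T.edgeSide v u ⊆
              {v} ∪ ⋃ w ∈ hfin.toFinset, W ∩ T.edgeSide w v := by
            rintro x ⟨hxW, hx⟩
            rcases T.edgeSide_subset_insert_iUnion u v hx with h | h
            · exact Or.inl h
            · right
              simp only [mem_iUnion, exists_prop, Finite.mem_toFinset] at h ⊢
              obtain ⟨w, hw, hxw⟩ := h
              exact ⟨w, hw, hxW, hxw⟩
          calc (W ∩ T.edgeSide v u).ncard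
              ≤ ({v} ∪ ⋃ w ∈ hfin.toFinset, W ∩ T.edgeSide w v : Set V).ncard :=
                ncard_le_ncard hsub
            _ ≤ ({v} : Set V).ncard + (⋃ w ∈ hfin.toFinset, W ∩ T.edgeSide w v).ncard :=
                ncard_union_le _ _
            _ ≤ 1 + ∑ w ∈ hfin.toFinset, (W ∩ T.edgeSide w v).ncard :=
                add_le_add (ncard_singleton v).le (Finset.set_ncard_biUnion_le _ _)
            _ ≤ 1 + hfin.toFinset.card * K := by
                gcongr
                refine Finset.sum_le_card_nsmul _ _ _ fun w hw' => ?_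
                rw [Finite.mem_toFinset] at hw'
                exact hw w hw'.1 hw'.2
            _ ≤ 1 + 2 * K := by
                rw [← ncard_eq_toFinset_card _ hfin]
                gcongr
        have := hsum u v
        omega
  obtain ⟨u⟩ := hconn.nonempty
  obtain ⟨v, huv⟩ := nonempty_of_ncard_ne_zero (hdeg u).1.ne'
  have huv : T.Adj u v := huv
  by_cases h : K < (W ∩ T.edgeSide v u).ncard
  · exact main _ u v rfl huv h
  · refine main _ v u rfl huv.symm ?_
    have := hsum u v
    omega

end SimpleGraph

/-- The edge of the complete graph joining two distinct vertices, as an element of `m(K_N)`. -/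
def KNGround.edge {N : ℕ} {i j : Fin N} (h : i ≠ j) : KNGround N :=
  Sum.inr ⟨s(i, j), by simpa using h⟩

/-- The vertex `i` of the complete graph, as an element of `m(K_N)`. -/
def KNGround.vertex {N : ℕ} (i : Fin N) : KNGround N := Sum.inl i

open KNGround

theorem badTriple_vertex_edge_vertex {N : ℕ} {i j : Fin N} (h : i ≠ j) :
    BadTriple N {vertex i, edge h, vertex j} :=
  ⟨i, j, _, h, rfl, rfl⟩

theorem BadTriple.eq_of_vertex_edge_vertex {N : ℕ} {a b c : Fin N} (h : a ≠ c)
    (hbad : BadTriple N {vertex a, edge h, vertex b}) : b = c := by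
  obtain ⟨i, j, p, hij, hp, hS⟩ := hbad
  have he : edge h ∈ ({Sum.inl i, Sum.inr p, Sum.inl j} : Set (KNGround N)) := by
    rw [← hS]; simp
  have hi : Sum.inl i ∈ ({vertex a, edge h, vertex b} : Set (KNGround N)) := by
    rw [hS]; exact Or.inl rfl
  have hj : Sum.inl j ∈ ({vertex a, edge h, vertex b} : Set (KNGround N)) := by
    rw [hS]; exact Or.inr (Or.inr rfl)
  have he' : s(a, c) = s(i, j) := by
    rcases he with he | he | he
    · cases he
    · rw [← hp, ← Sum.inr.inj he]
    · cases he
  have hi' : i = a ∨ i = b := by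
    rcases hi with hi | hi | hi
    · exact Or.inl (Sum.inl.inj hi)
    · cases hi
    · exact Or.inr (Sum.inl.inj hi)
  have hj' : j = a ∨ j = b := by
    rcases hj with hj | hj | hj
    · exact Or.inl (Sum.inl.inj hj)
    · cases hj
    · exact Or.inr (Sum.inl.inj hj)
  rw [Sym2.eq_iff] at he'
  grind

/-- Distinct vertices outside `U`, each joined to a vertex of `U` by an edge of `U`, give
inequivalent subsets of `U`. -/
theorem SimClassesLE.ncard_le_of_edges {α : Type*} {M : Matroid α} {N K : ℕ} {U : Set α}
    (hU : SimClassesLE M U K) {f : α → KNGround N} {g : KNGround N → α}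
    (hgE : ∀ x, g x ∈ M.E) (hfg : ∀ x, f (g x) = x)
    (hindep : ∀ X ⊆ M.E, (M.Indep X ↔ (X.ncard ≤ 3 ∧ ¬ BadTriple N (f '' X))))
    {B : Set (Fin N)} (hB : ∀ b ∈ B, g (vertex b) ∉ U)
    (hedge : ∀ b ∈ B, ∃ a, ∃ h : a ≠ b, g (vertex a) ∈ U ∧ g (edge h) ∈ U) :
    B.ncard ≤ K := by
  obtain ⟨c, hc⟩ := hU
  choose! a hab haU heU using hedge
  let X : B → Set α := fun b => {g (vertex (a b)), g (edge (hab b b.2))}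
  have hXU : ∀ b, X b ⊆ U := by
    rintro b x (rfl | rfl)
    · exact haU b b.2
    · exact heU b b.2
  have himage : ∀ b b' : B, f '' (X b ∪ {g (vertex b')}) =
      {vertex (a b), edge (hab b b.2), vertex (b' : Fin N)} := by
    intro b b'
    simp only [X, image_insert_eq, image_singleton, hfg, insert_union, singleton_union]
  have hsub : ∀ b b' : B, X b ∪ {g (vertex b')} ⊆ M.E := by
    rintro b b' x ((rfl | rfl) | rfl) <;> exact hgE _
  have hinj : Function.Injective fun b => c (X b) := by
    intro b b' hbb'
    have hsim := hc _ _ (hXU b) (hXU b') hbb' {g (vertex b)}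
      (singleton_subset_iff.2 ⟨hgE _, hB b b.2⟩)
    have hdep : ¬ M.Indep (X b ∪ {g (vertex b)}) := by
      rw [hindep _ (hsub b b), himage]
      exact fun h => h.2 (badTriple_vertex_edge_vertex _)
    rw [hsim, hindep _ (hsub b' b), himage] at hdep
    have hcard : (X b' ∪ {g (vertex b)}).ncard ≤ 3 :=
      by
      refine (ncard_union_le _ _).trans (add_le_add ?_ (ncard_singleton _).le)
      exact (ncard_insert_le _ _).trans (by rw [ncard_singleton])
    exact Subtype.ext (BadTriple.eq_of_vertex_edge_vertex _
      (not_not.1 fun h => hdep ⟨hcard, h⟩))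
  have := Nat.card_le_card_of_injective _ hinj
  rwa [Nat.card_fin, Nat.card_coe_set_eq] at this

/-- for every K there is N₀ such that for all N ≥ N₀, every matroid
isomorphic to m(K_N) has decomposition-width greater than K. -/
theorem mKN_dw_large :
    ∀ K : ℕ, 0 < K → ∃ N₀ : ℕ, 0 < N₀ ∧ ∀ N : ℕ, N₀ ≤ N →
      ∀ (α : Type u) (M : Matroid α), IsMKN N M → ¬ dwLE M K := by
  intro K _
  refine ⟨3 * K + 2, by omega, ?_⟩
  rintro N hN α M ⟨f, hf, hindep⟩ ⟨D, hD⟩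
  have := D.fin
  choose g hgE hfg using fun x : KNGround N => hf.surjOn (mem_univ x)
  have hginj : Function.Injective g := Function.LeftInverse.injective hfg
  let leaf : Fin N → D.V := fun i => (D.leafEquiv ⟨g (vertex i), hgE _⟩).1
  have hleaf : Function.Injective leaf := by
    intro i j hij
    have h := congrArg Subtype.val (D.leafEquiv.injective (Subtype.ext hij))
    exact Sum.inl.inj (hginj h)
  obtain ⟨u, v, huv, hu, hv⟩ := SimpleGraph.exists_adj_balanced (W := range leaf) (K := K)
    D.conn D.acyc (fun w => by have := D.deg w; omega)
    (by rwa [← image_univ, ncard_image_of_injective _ hleaf, ncard_univ, Nat.card_fin])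
  let side : D.V → D.V → Set α := fun u v =>
    {x | ∃ h : x ∈ M.E, (D.leafEquiv ⟨x, h⟩).1 ∈ D.T.edgeSide u v}
  have hside : ∀ u v, D.T.Adj u v → SimClassesLE M (side u v) K :=
    fun u v h => hD _ ⟨u, v, h, rfl⟩
  have hmem : ∀ u v i, g (vertex i) ∈ side u v ↔ leaf i ∈ D.T.edgeSide u v :=
    fun u v i => ⟨fun h => h.2, fun h => ⟨hgE _, h⟩⟩
  have hcard : ∀ u v, (range leaf ∩ D.T.edgeSide u v).ncard =
      {i | g (vertex i) ∈ side u v}.ncard := by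
    intro u v
    rw [← ncard_image_of_injective _ hleaf]
    congr 1
    ext x
    constructor
    · rintro ⟨⟨i, rfl⟩, hi⟩
      exact ⟨i, (hmem u v i).2 hi, rfl⟩
    · rintro ⟨i, hi, rfl⟩
      exact ⟨⟨i, rfl⟩, (hmem u v i).1 hi⟩
  have hdisj : ∀ x, x ∈ side u v → x ∉ side v u := fun x h h' =>
    Set.disjoint_left.1 (D.acyc.disjoint_edgeSide huv) h.2 h'.2
  have hcover : ∀ x, x ∈ M.E → x ∈ side u v ∨ x ∈ side v u := fun x h =>
    (D.conn.mem_edgeSide_or u v _).imp (⟨h, ·⟩) (⟨h, ·⟩)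
  rw [hcard] at hu hv
  by_cases hall : ∀ b ∈ {i | g (vertex i) ∈ side v u},
      ∃ a, ∃ h : a ≠ b, g (vertex a) ∈ side u v ∧ g (edge h) ∈ side u v
  · exact hv.not_ge ((hside u v huv).ncard_le_of_edges hgE hfg hindep
      (fun b hb h => hdisj _ h hb) hall)
  · push Not at hall
    obtain ⟨b, hb, hbe⟩ := hall
    refine hu.not_ge ((hside v u huv.symm).ncard_le_of_edges hgE hfg hindep
      (fun a ha => hdisj _ ha) fun a ha => ?_)
    have hne : a ≠ b := by
      rintro rfl
      exact hdisj _ ha hb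
    refine ⟨b, hne.symm, hb, ?_⟩
    have hswap : edge hne.symm = edge hne :=
      congrArg Sum.inr (Subtype.ext Sym2.eq_swap)
    rw [hswap]
    exact (hcover _ (hgE _)).resolve_left (hbe a hne ha)
end

section
/- The class of transversal matroids is not pigeonhole: there is a positive integer λ such that for every integer ρ there exists a transversal matroid M with branch-width at most λ and decomposition-width greater than ρ. -/
open Set

/-- `M` is a transversal matroid. -/
def Transversal {α : Type*} (M : Matroid α) : Prop :=
  ∃ (r : ℕ) (A : Fin r → Set α), ∀ X ⊆ M.E,
    (M.Indep X ↔ ∃ f : α → Fin r, Set.InjOn f X ∧ ∀ x ∈ X, x ∈ A (f x))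

/-! ### Transversal matroids -/

/-- The transversal matroid on a finite ground set `E` presented by the family `A`. -/
noncomputable def transversalMatroid {α ι : Type*} [Finite ι] [Nonempty ι] {E : Set α}
    (hE : E.Finite) (A : ι → Set α) : Matroid α :=
  (IndepMatroid.ofFinite hE
    (fun X ↦ X ⊆ E ∧ ∃ f : α → ι, InjOn f X ∧ ∀ x ∈ X, x ∈ A (f x))
    ⟨empty_subset _, fun _ ↦ Classical.arbitrary ι, by simp, by simp⟩
    (fun _ _ ⟨hJ, f, hf, hA⟩ hIJ ↦ ⟨hIJ.trans hJ, f, hf.mono hIJ, fun x hx ↦ hA x (hIJ hx)⟩)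
    (by
      rintro I J ⟨hI, f, hf, hfA⟩ ⟨hJ, g, hg, hgA⟩ hlt
      classical
      have hIfin := hE.subset hI
      -- Move the matching of `I` towards that of `J` until it frees an index used by `J \ I`.
      induction hd : {x ∈ I | f x ≠ g x}.ncard using Nat.strong_induction_on generalizing f with
      | _ d ih =>
        have hcard : (f '' I).ncard < (g '' J).ncard := by
          rwa [hf.ncard_image, hg.ncard_image]
        obtain ⟨_, ⟨y, hyJ, rfl⟩, hy⟩ := exists_mem_notMem_of_ncard_lt_ncard hcard
        have hne : ∀ x ∈ I, f x ≠ g y := fun x hx h ↦ hy ⟨x, hx, h⟩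
        have hinj : InjOn (Function.update f y (g y)) (insert y I) := by
          intro a ha b hb hab
          have ha' : a ≠ y → a ∈ I := fun h ↦ (mem_insert_iff.1 ha).resolve_left h
          have hb' : b ≠ y → b ∈ I := fun h ↦ (mem_insert_iff.1 hb).resolve_left h
          by_cases h1 : a = y <;> by_cases h2 : b = y <;> simp [Function.update, h1, h2] at hab ⊢
          · exact (hne b (hb' h2) hab.symm).elim
          · exact (hne a (ha' h1) hab).elim
          · exact hf (ha' h1) (hb' h2) hab
        have hmem : ∀ x ∈ insert y I, x ∈ A (Function.update f y (g y) x) := by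
          intro x hx
          by_cases h : x = y
          · subst h; simpa using hgA x hyJ
          · simpa [h] using hfA x ((mem_insert_iff.1 hx).resolve_left h)
        by_cases hyI : y ∈ I
        · rw [insert_eq_of_mem hyI] at hinj hmem
          refine ih _ ?_ _ hinj hmem rfl
          rw [← hd]
          refine ncard_lt_ncard ⟨fun x hx ↦ ?_, fun h ↦ ?_⟩ (hIfin.subset (sep_subset _ _))
          · by_cases h : x = y
            · simp [h] at hx
            · simpa [h] using hx
          · simpa using (h ⟨hyI, hne y hyI⟩).2
        · exact ⟨y, hyJ, hyI, insert_subset (hJ hyJ) hI, _, hinj, hmem⟩)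
    (fun _ h ↦ h.1)).matroid

section transversalMatroid

variable {α ι : Type*} [Finite ι] [Nonempty ι] {E : Set α} (hE : E.Finite) (A : ι → Set α)

theorem transversalMatroid_indep_iff {X : Set α} :
    (transversalMatroid hE A).Indep X ↔
      X ⊆ E ∧ ∃ f : α → ι, InjOn f X ∧ ∀ x ∈ X, x ∈ A (f x) := Iff.rfl

theorem transversal_transversalMatroid : Transversal (transversalMatroid hE A) := by
  obtain ⟨e⟩ : Nonempty (ι ≃ Fin (Nat.card ι)) := ⟨Finite.equivFin ι⟩
  refine ⟨Nat.card ι, A ∘ e.symm, fun X hX ↦ ?_⟩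
  rw [transversalMatroid_indep_iff]
  constructor
  · rintro ⟨-, f, hf, hA⟩
    exact ⟨e ∘ f, e.injective.comp_injOn hf, by simpa using hA⟩
  · rintro ⟨f, hf, hA⟩
    exact ⟨hX, e.symm ∘ f, e.symm.injective.comp_injOn hf, hA⟩

end transversalMatroid

/-! ### Connectivity in matroids of small corank -/

theorem mrank_le_ncard {α : Type*} (M : Matroid α) {X : Set α} (hX : X.Finite) :
    mrank M X ≤ X.ncard := by
  refine csSup_le ⟨_, ∅, empty_subset _, M.empty_indep, rfl⟩ ?_
  rintro _ ⟨I, hI, -, rfl⟩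
  exact ncard_le_ncard hI hX

theorem Matroid.Indep.ncard_le_mrank {α : Type*} {M : Matroid α} {I X : Set α} (hI : M.Indep I)
    (hIX : I ⊆ X) (hX : X.Finite) : I.ncard ≤ mrank M X := by
  refine le_csSup ⟨X.ncard, ?_⟩ ⟨I, hIX, hI, rfl⟩
  rintro _ ⟨J, hJ, -, rfl⟩
  exact ncard_le_ncard hJ hX

theorem connVal_le_of_indep {α : Type*} {M : Matroid α} {I U : Set α} {c : ℕ}
    (hE : M.E.Finite) (hI : M.Indep I) (hc : M.E.ncard ≤ I.ncard + c) (hU : U ⊆ M.E) :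
    connVal M U ≤ c := by
  have h1 := mrank_le_ncard M (hE.subset hU)
  have h2 := mrank_le_ncard M (hE.subset (sdiff_subset (s := M.E) (t := U)))
  have h3 := hI.ncard_le_mrank hI.subset_ground hE
  have h4 := ncard_sdiff_add_ncard_of_subset hU hE
  unfold connVal
  omega

/-! ### A cubic tree with a prescribed number of leaves -/

/-- The complete binary heap on `{1, …, 2 * k + 1}` with an extra leaf `0` attached to its root. -/
def heapTree (k : ℕ) : SimpleGraph (Fin (2 * k + 2)) where
  Adj u v := u ≠ v ∧ ((u : ℕ) = v / 2 ∨ (v : ℕ) = u / 2)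
  symm := ⟨fun _ _ h ↦ ⟨h.1.symm, h.2.symm⟩⟩
  loopless := ⟨fun _ h ↦ h.1 rfl⟩

theorem heapTree_connected (k : ℕ) : (heapTree k).Connected := by
  have h0 : ∀ m (hm : m < 2 * k + 2), (heapTree k).Reachable ⟨m, hm⟩ ⟨0, by omega⟩ := by
    intro m
    induction m using Nat.strong_induction_on with
    | _ m ih =>
      intro hm
      rcases Nat.eq_zero_or_pos m with rfl | hpos
      · exact .refl _
      · refine SimpleGraph.Reachable.trans (SimpleGraph.Adj.reachable ?_)
          (ih (m / 2) (by omega) (by omega))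
        refine ⟨fun h ↦ ?_, Or.inr rfl⟩
        have := congrArg Fin.val h
        simp at this
        omega
  exact { preconnected := fun u v ↦ (h0 u u.2).trans (h0 v v.2).symm, nonempty := ⟨⟨0, by omega⟩⟩ }

theorem heapTree_isTree (k : ℕ) : (heapTree k).IsTree := by
  rw [SimpleGraph.isTree_iff_connected_and_card]
  refine ⟨heapTree_connected k, le_antisymm ?_
    (heapTree_connected k).card_vert_le_card_edgeSet_add_one⟩
  have hsub : (heapTree k).edgeSet ⊆
      (fun v : Fin (2 * k + 2) ↦ s(v, (⟨v / 2, by omega⟩ : Fin (2 * k + 2)))) ''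
        {⟨0, by omega⟩}ᶜ := by
    intro e
    induction e using Sym2.ind with
    | _ u v =>
      intro huv
      obtain ⟨hne, h⟩ : u ≠ v ∧ ((u : ℕ) = v / 2 ∨ (v : ℕ) = u / 2) := huv
      rcases h with h | h
      · refine ⟨v, fun hv ↦ hne ?_, ?_⟩
        · simp only [mem_singleton_iff, Fin.ext_iff] at hv ⊢
          omega
        · rw [Sym2.eq_swap]
          simp only [← h]
      · refine ⟨u, fun hu ↦ hne ?_, ?_⟩
        · simp only [mem_singleton_iff, Fin.ext_iff] at hu ⊢
          omega
        · simp only [← h]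
  have h1 := (ncard_le_ncard hsub).trans ncard_image_le
  rw [ncard_compl, ncard_singleton, Nat.card_eq_fintype_card, Fintype.card_fin] at h1
  rw [Nat.card_coe_set_eq, Nat.card_eq_fintype_card, Fintype.card_fin]
  omega

theorem heapTree_neighborSet_leaf {k : ℕ} (v : Fin (2 * k + 2)) (hv : v.1 = 0 ∨ k < v.1) :
    ((heapTree k).neighborSet v).ncard = 1 := by
  rcases hv with hv | hv
  · refine ncard_eq_one.2 ⟨⟨1, by omega⟩, ?_⟩
    ext w
    simp only [SimpleGraph.mem_neighborSet, heapTree, mem_singleton_iff, Fin.ext_iff, ne_eq]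
    omega
  · refine ncard_eq_one.2 ⟨⟨v / 2, by omega⟩, ?_⟩
    ext w
    simp only [SimpleGraph.mem_neighborSet, heapTree, mem_singleton_iff, Fin.ext_iff, ne_eq]
    omega

theorem heapTree_neighborSet_inner {k : ℕ} (v : Fin (2 * k + 2)) (hv : ¬(v.1 = 0 ∨ k < v.1)) :
    ((heapTree k).neighborSet v).ncard = 3 := by
  refine ncard_eq_three.2 ⟨⟨v / 2, by omega⟩, ⟨2 * v, by omega⟩, ⟨2 * v + 1, by omega⟩, ?_, ?_, ?_,
    ?_⟩
  · simp only [ne_eq, Fin.ext_iff]; omega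
  · simp only [ne_eq, Fin.ext_iff]; omega
  · simp only [ne_eq, Fin.ext_iff]; omega
  · ext w
    simp only [SimpleGraph.mem_neighborSet, heapTree, mem_singleton_iff, mem_insert_iff,
      Fin.ext_iff, ne_eq]
    omega

theorem heapTree_card_leaves (k : ℕ) :
    Nat.card {v : Fin (2 * k + 2) // ((heapTree k).neighborSet v).ncard = 1} = k + 2 := by
  have hleaf (v : Fin (2 * k + 2)) :
      ((heapTree k).neighborSet v).ncard = 1 ↔ v.1 = 0 ∨ k < v.1 := by
    refine ⟨fun h ↦ ?_, heapTree_neighborSet_leaf v⟩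
    by_contra hv
    have := heapTree_neighborSet_inner v hv
    omega
  rw [← Nat.card_fin (k + 2)]
  symm
  refine Nat.card_congr (Equiv.ofBijective
    (fun i ↦ ⟨⟨if i.1 = 0 then 0 else k + i, by split_ifs <;> omega⟩, (hleaf _).2 ?_⟩) ⟨?_, ?_⟩)
  · dsimp only
    split_ifs <;> omega
  · intro i j hij
    simp only [Subtype.mk.injEq, Fin.mk.injEq] at hij
    apply Fin.ext
    split_ifs at hij <;> omega
  · rintro ⟨v, hv⟩
    rw [hleaf] at hv
    refine ⟨⟨v - k, by omega⟩, Subtype.ext (Fin.ext ?_)⟩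
    dsimp only
    split_ifs <;> omega

theorem nonempty_decomp {α : Type*} (M : Matroid α) (hfin : M.E.Finite) (h : 2 ≤ M.E.ncard) :
    Nonempty (Decomp M) := by
  obtain ⟨k, hk⟩ := Nat.exists_eq_add_of_le' h
  have : Finite M.E := hfin
  have hcard : Nat.card M.E =
      Nat.card {v : Fin (2 * k + 2) // ((heapTree k).neighborSet v).ncard = 1} := by
    rw [heapTree_card_leaves, Nat.card_coe_set_eq, hk]
  exact ⟨{
    V := Fin (2 * k + 2)
    fin := inferInstance
    T := heapTree k
    conn := heapTree_connected k
    acyc := (heapTree_isTree k).isAcyclic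
    deg := fun v ↦ (em _).imp (heapTree_neighborSet_leaf v) (heapTree_neighborSet_inner v)
    leafEquiv := (Finite.card_eq.1 hcard).some }⟩

theorem Decomp.Displays.subset_ground {α : Type*} {M : Matroid α} {D : Decomp M} {U : Set α}
    (h : D.Displays U) : U ⊆ M.E := by
  obtain ⟨u, v, -, rfl⟩ := h
  exact fun x ⟨hx, _⟩ ↦ hx

/-! ### Balanced edges of subcubic trees -/

namespace SimpleGraph

variable {V : Type*} {T : SimpleGraph V}

theorem Connected.exists_adj_reachable_deleteEdges (hT : T.Connected) {v x : V} (hx : x ≠ v) :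
    ∃ w, T.Adj v w ∧ (T.deleteEdges {s(w, v)}).Reachable x w := by
  obtain ⟨p, hp⟩ := (hT.preconnected v x).exists_isPath
  cases p with
  | nil => exact (hx rfl).elim
  | cons h q =>
    rename_i w
    rw [Walk.cons_isPath_iff] at hp
    refine ⟨w, h, (reachable_deleteEdges_iff_exists_walk.2 ⟨q, fun hq ↦ hp.2 ?_⟩).symm⟩
    exact q.snd_mem_support_of_mem_edges hq

theorem Connected.reachable_deleteEdges_or (hT : T.Connected) (u v x : V) :
    (T.deleteEdges {s(u, v)}).Reachable x u ∨ (T.deleteEdges {s(u, v)}).Reachable x v := by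
  obtain ⟨p⟩ := hT.preconnected x u
  induction p with
  | nil => exact Or.inl (.refl _)
  | @cons a b c h q ih =>
    by_cases he : s(a, b) = s(c, v)
    · rcases Sym2.eq_iff.1 he with ⟨rfl, rfl⟩ | ⟨rfl, rfl⟩
      · exact Or.inl (.refl _)
      · exact Or.inr (.refl _)
    · have hab : (T.deleteEdges {s(c, v)}).Adj a b := by
        rw [deleteEdges_adj]
        exact ⟨h, he⟩
      exact ih.imp hab.reachable.trans hab.reachable.trans

/-- In a tree of maximum degree three, some edge separates any sufficiently large family of
distinct vertices into two large parts. -/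
theorem IsTree.exists_balanced_edge [Finite V] (hT : T.IsTree)
    (hdeg : ∀ v, (T.neighborSet v).ncard ≤ 3) {κ : Type*} [Finite κ] {b : κ → V}
    (hb : Function.Injective b) {m : ℕ} (hm : 3 * m + 1 < Nat.card κ) :
    ∃ u v, T.Adj u v ∧ m < {i | (T.deleteEdges {s(u, v)}).Reachable (b i) u}.ncard ∧
      m < {i | (T.deleteEdges {s(u, v)}).Reachable (b i) v}.ncard := by
  classical
  by_cases hout : ∀ v, ∃ w, T.Adj v w ∧
      m < {i | (T.deleteEdges {s(w, v)}).Reachable (b i) w}.ncard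
  · choose g hg hlarge using hout
    have hcard : Nat.card T.edgeSet < Nat.card V := by
      have := (isTree_iff_connected_and_card.1 hT).2
      omega
    have hni : ¬ Function.Injective (fun v ↦ (⟨s(g v, v), (hg v).symm⟩ : T.edgeSet)) :=
      fun h ↦ (Nat.card_le_card_of_injective _ h).not_gt hcard
    simp only [Function.Injective, not_forall] at hni
    obtain ⟨v, w, he, hne⟩ := hni
    rcases Sym2.eq_iff.1 (congrArg Subtype.val he) with ⟨-, h⟩ | ⟨h1, h2⟩
    · exact (hne h).elim
    · refine ⟨w, v, h1 ▸ (hg v).symm, ?_, ?_⟩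
      · simpa [h1] using hlarge v
      · rw [Sym2.eq_swap]
        simpa [← h2] using hlarge w
  · push Not at hout
    obtain ⟨v, hv⟩ := hout
    have : Fintype κ := Fintype.ofFinite κ
    have : Fintype V := Fintype.ofFinite V
    exfalso
    have hcover : (Finset.univ : Finset κ) ⊆ Finset.univ.filter (fun i ↦ b i = v) ∪
        (T.neighborFinset v).biUnion fun w ↦
          Finset.univ.filter fun i ↦ (T.deleteEdges {s(w, v)}).Reachable (b i) w := by
      intro i _
      by_cases hi : b i = v
      · simp [hi]
      · simpa [hi] using hT.connected.exists_adj_reachable_deleteEdges hi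
    have h1 := (Finset.card_le_card hcover).trans (Finset.card_union_le _ _)
    have h2 : (Finset.univ.filter (fun i ↦ b i = v)).card ≤ 1 :=
      Finset.card_le_one.2 fun i hi j hj ↦ hb (by simp_all)
    have h3 := Finset.card_biUnion_le_card_mul (T.neighborFinset v)
      (fun w ↦ Finset.univ.filter fun i ↦ (T.deleteEdges {s(w, v)}).Reachable (b i) w) m
      (fun w hw ↦ by
        have := hv w (by simpa using hw)
        rwa [ncard_eq_toFinset_card', toFinset_ofPred] at this)
    have h4 : (T.neighborFinset v).card ≤ 3 := by
      have := hdeg v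
      rwa [ncard_eq_toFinset_card'] at this
    have h5 := Nat.mul_le_mul_right m h4
    rw [Nat.card_eq_fintype_card, ← Finset.card_univ] at hm
    omega

end SimpleGraph

/-! ### The family of examples -/

/-- A presentation of a transversal matroid of corank three: the dual has points `b i` in general
position, one point on each line spanned by two of them, and three further points. -/
def linePresentation (n : ℕ) :
    Fin n ⊕ Fin n × Fin n → Set ((Fin n ⊕ Fin n × Fin n) ⊕ Fin 3)
  | .inl i => insert (.inl (.inl i)) (range Sum.inr)
  | .inr e => {.inl (.inr e), .inl (.inl e.1), .inl (.inl e.2)}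

theorem linePresentation_self {n : ℕ} (k : Fin n ⊕ Fin n × Fin n) :
    .inl k ∈ linePresentation n k := by
  cases k <;> simp [linePresentation]

/-- The complement of a triple that is independent in the dual can be matched. -/
theorem exists_matching_compl {n : ℕ} {x y z : Fin n} {e : Fin n × Fin n} (hxy : x ≠ y)
    (hzx : z ≠ x) (hzy : z ≠ y) (hz : z = e.1 ∨ z = e.2) :
    ∃ f : (Fin n ⊕ Fin n × Fin n) ⊕ Fin 3 → Fin n ⊕ Fin n × Fin n,
      InjOn f {.inl (.inl x), .inl (.inr e), .inl (.inl y)}ᶜ ∧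
        ∀ w ∈ ({.inl (.inl x), .inl (.inr e), .inl (.inl y)}ᶜ : Set _),
          w ∈ linePresentation n (f w) := by
  refine ⟨Sum.elim (fun k ↦ if k = .inl z then .inr e else k)
    ![.inl x, .inl y, .inl z], ?_, ?_⟩
  · rintro (k | t) hk (l | s) hl h
    · simp only [Sum.elim_inl] at h
      split_ifs at h <;> simp_all
    · fin_cases s <;> simp at h hk <;> split_ifs at h <;> simp_all
    · fin_cases t <;> simp at h hl <;> split_ifs at h <;> simp_all
    · fin_cases t <;> fin_cases s <;> simp_all [eq_comm]
  · rintro (k | t) hk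
    · simp only [Sum.elim_inl]
      split_ifs with h
      · subst h
        rcases hz with h | h <;> simp [linePresentation, h]
      · exact linePresentation_self k
    · fin_cases t <;> simp [linePresentation]

/-- The complement of a line of the dual cannot be matched. -/
theorem not_exists_matching_compl {n : ℕ} {x y : Fin n} {e : Fin n × Fin n}
    (he : e = (x, y) ∨ e = (y, x)) :
    ¬ ∃ f : (Fin n ⊕ Fin n × Fin n) ⊕ Fin 3 → Fin n ⊕ Fin n × Fin n,
      InjOn f {.inl (.inl x), .inl (.inr e), .inl (.inl y)}ᶜ ∧
        ∀ w ∈ ({.inl (.inl x), .inl (.inr e), .inl (.inl y)}ᶜ : Set _),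
          w ∈ linePresentation n (f w) := by
  rintro ⟨f, hf, hA⟩
  have hmaps : ∀ w ∈ ({.inl (.inl x), .inl (.inr e), .inl (.inl y)}ᶜ : Set _),
      f w ∈ ({.inr e}ᶜ : Set (Fin n ⊕ Fin n × Fin n)) := by
    intro w hw hfw
    have := hA w hw
    rw [mem_singleton_iff.1 hfw] at this
    rcases he with rfl | rfl <;> simp [linePresentation] at this hw <;> tauto
  have h1 := ncard_le_ncard_of_injOn f hmaps hf
  rw [ncard_compl, ncard_compl, ncard_singleton] at h1
  have h2 : ({.inl (.inl x), .inl (.inr e), .inl (.inl y)} :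
      Set ((Fin n ⊕ Fin n × Fin n) ⊕ Fin 3)).ncard ≤ 3 :=
    (ncard_insert_le _ _).trans (Nat.add_le_add_right
      ((ncard_insert_le _ _).trans_eq (by rw [ncard_singleton])) 1)
  have : Nonempty (Fin n) := ⟨x⟩
  have h3 : 0 < Nat.card (Fin n ⊕ Fin n × Fin n) := Nat.card_pos
  rw [Nat.card_sum (β := Fin 3), Nat.card_fin] at h1
  omega

section lineMatroid

variable {α : Type*} {n : ℕ} [NeZero n] (φ : (Fin n ⊕ Fin n × Fin n) ⊕ Fin 3 ↪ α)

/-- The transversal matroid presented by `linePresentation`, transported to `α`. -/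
noncomputable def lineMatroid : Matroid α :=
  transversalMatroid (finite_range φ) fun k ↦ φ '' linePresentation n k

theorem lineMatroid_E : (lineMatroid φ).E = range φ := rfl

theorem lineMatroid_indep_image_iff (W : Set ((Fin n ⊕ Fin n × Fin n) ⊕ Fin 3)) :
    (lineMatroid φ).Indep (φ '' W) ↔
      ∃ f : (Fin n ⊕ Fin n × Fin n) ⊕ Fin 3 → Fin n ⊕ Fin n × Fin n,
        InjOn f W ∧ ∀ w ∈ W, w ∈ linePresentation n (f w) := by
  rw [lineMatroid, transversalMatroid_indep_iff]
  constructor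
  · rintro ⟨-, f, hf, hA⟩
    refine ⟨f ∘ φ, fun a ha b hb hab ↦ φ.injective
      (hf (mem_image_of_mem φ ha) (mem_image_of_mem φ hb) hab), fun w hw ↦ ?_⟩
    exact (φ.injective.mem_set_image).1 (hA (φ w) (mem_image_of_mem φ hw))
  · rintro ⟨f, hf, hA⟩
    have hcomp (w) : f (Function.invFun φ (φ w)) = f w := by
      rw [Function.leftInverse_invFun φ.injective]
    refine ⟨image_subset_range _ _, f ∘ Function.invFun φ, ?_, ?_⟩
    · rintro _ ⟨a, ha, rfl⟩ _ ⟨b, hb, rfl⟩ hab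
      simp only [Function.comp_apply, hcomp] at hab
      rw [hf ha hb hab]
    · rintro _ ⟨a, ha, rfl⟩
      simp only [Function.comp_apply, hcomp]
      exact mem_image_of_mem φ (hA a ha)

theorem transversal_lineMatroid : Transversal (lineMatroid φ) :=
  transversal_transversalMatroid _ _

theorem lineMatroid_ncard_ground :
    (lineMatroid φ).E.ncard = Nat.card (Fin n ⊕ Fin n × Fin n) + 3 := by
  rw [lineMatroid_E, ← image_univ, ncard_image_of_injective _ φ.injective, ncard_univ,
    Nat.card_sum (β := Fin 3), Nat.card_fin]

theorem bwLE_lineMatroid : bwLE (lineMatroid φ) 4 := by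
  have hcard := lineMatroid_ncard_ground φ
  obtain ⟨D⟩ := nonempty_decomp (lineMatroid φ) (finite_range φ) (by omega)
  refine ⟨D, fun U hU ↦ Nat.succ_le_succ ?_⟩
  refine connVal_le_of_indep (I := φ '' range Sum.inl) (finite_range φ) ?_ ?_ hU.subset_ground
  · rw [lineMatroid_indep_image_iff]
    refine ⟨Sum.elim id fun _ ↦ .inl 0, ?_, ?_⟩
    · rintro _ ⟨a, rfl⟩ _ ⟨b, rfl⟩ h
      simpa using h
    · rintro _ ⟨a, rfl⟩
      exact linePresentation_self a
  · rw [hcard, ncard_image_of_injective _ φ.injective, ← image_univ,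
      ncard_image_of_injective _ Sum.inl_injective, ncard_univ]

/-- Lines of the dual with two points in `U` and pairwise distinct third points outside `U` yield
inequivalent subsets of `U`. -/
theorem ncard_le_of_simClassesLE {U : Set α} (hU : U ⊆ range φ) {k : ℕ}
    (hk : SimClassesLE (lineMatroid φ) U k) (J : Set (Fin n)) (c : Fin n → Fin n)
    (e : Fin n → Fin n × Fin n) (he : ∀ j, e j = (c j, j) ∨ e j = (j, c j))
    (hJ : ∀ j ∈ J, φ (.inl (.inl j)) ∉ U) (hc : ∀ j ∈ J, φ (.inl (.inl (c j))) ∈ U)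
    (heU : ∀ j ∈ J, φ (.inl (.inr (e j))) ∈ U) : J.ncard ≤ k := by
  obtain ⟨f, hf⟩ := hk
  let X (j : Fin n) : Set α := U \ {φ (.inl (.inl (c j))), φ (.inl (.inr (e j)))}
  have hXU (j) : X j ⊆ U := sdiff_subset
  have hunion : ∀ i ∈ J, ∀ j ∈ J, X i ∪ ((lineMatroid φ).E \ U) \ {φ (.inl (.inl j))} =
      φ '' {.inl (.inl (c i)), .inl (.inr (e i)), .inl (.inl j)}ᶜ := by
    intro i hi j hj
    rw [image_compl_eq_range_sdiff_image φ.injective, image_insert_eq, image_pair, lineMatroid_E]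
    ext a
    have h1 := hJ j hj
    have h2 := hc i hi
    have h3 := heU i hi
    have h4 := @hU a
    simp only [X, mem_union, mem_sdiff, mem_insert_iff, mem_singleton_iff]
    by_cases ha : a ∈ U
    · have : a ≠ φ (.inl (.inl j)) := fun h ↦ h1 (h ▸ ha)
      tauto
    · have h5 : a ≠ φ (.inl (.inl (c i))) := fun h ↦ ha (h ▸ h2)
      have h6 : a ≠ φ (.inl (.inr (e i))) := fun h ↦ ha (h ▸ h3)
      tauto
  have hinj : InjOn (f ∘ X) J := by
    intro j hj i hi hij
    by_contra hne
    have hsim := hf _ _ (hXU j) (hXU i) hij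
      (((lineMatroid φ).E \ U) \ {φ (.inl (.inl j))}) sdiff_subset
    rw [hunion j hj j hj, hunion i hi j hj, lineMatroid_indep_image_iff,
      lineMatroid_indep_image_iff] at hsim
    have hci : c i ≠ j := fun h ↦ hJ j hj (h ▸ hc i hi)
    have hii : i ≠ c i := fun h ↦ hJ i hi (by rw [h]; exact hc i hi)
    refine not_exists_matching_compl (he j) (hsim.2 (exists_matching_compl hci hii (Ne.symm hne) ?_))
    rcases he i with h | h <;> simp [h]
  simpa using ncard_le_ncard_of_injOn (t := univ) (f ∘ X) (fun _ _ ↦ mem_univ _) hinj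

theorem not_dwLE_lineMatroid {ρ : ℕ} (hρ : 3 * ρ + 1 < n) : ¬ dwLE (lineMatroid φ) ρ := by
  rintro ⟨D, hD⟩
  have := D.fin
  let leaf (x : (Fin n ⊕ Fin n × Fin n) ⊕ Fin 3) : D.V := (D.leafEquiv ⟨φ x, mem_range_self x⟩).1
  have hleaf : Function.Injective leaf := fun x y h ↦ by
    exact φ.injective (congrArg Subtype.val (D.leafEquiv.injective (Subtype.ext h)))
  obtain ⟨u, v, huv, hu, hv⟩ := SimpleGraph.IsTree.exists_balanced_edge
    ⟨D.conn, D.acyc⟩ (fun v ↦ by rcases D.deg v with h | h <;> omega)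
    (hleaf.comp (Sum.inl_injective.comp Sum.inl_injective)) (m := ρ) (by simpa using hρ)
  let side (w : D.V) : Set α := {x | ∃ h : x ∈ (lineMatroid φ).E,
    (D.T.deleteEdges {s(u, v)}).Reachable (D.leafEquiv ⟨x, h⟩).1 w}
  have hmem (w : D.V) (x) : φ x ∈ side w ↔ (D.T.deleteEdges {s(u, v)}).Reachable (leaf x) w :=
    ⟨fun h ↦ h.2, fun h ↦ ⟨mem_range_self x, h⟩⟩
  have hsub (w : D.V) : side w ⊆ range φ := fun x h ↦ h.1
  have hclu : SimClassesLE (lineMatroid φ) (side u) ρ := hD _ ⟨u, v, huv, rfl⟩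
  have hclv : SimClassesLE (lineMatroid φ) (side v) ρ :=
    hD _ ⟨v, u, huv.symm, by simp only [side, Sym2.eq_swap]⟩
  have hcover (x) : φ x ∈ side u ∨ φ x ∈ side v := by
    simpa only [hmem] using D.conn.reachable_deleteEdges_or u v (leaf x)
  have hdisj (x) : φ x ∈ side u → φ x ∉ side v := by
    simp only [hmem]
    exact fun h1 h2 ↦ SimpleGraph.isBridge_iff.1
      (SimpleGraph.isAcyclic_iff_forall_adj_isBridge.1 D.acyc huv) (h1.symm.trans h2)
  have hdisj' (x) (h : φ x ∈ side v) : φ x ∉ side u := fun h' ↦ hdisj x h' h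
  let P (w : D.V) : Set (Fin n) := {i | φ (.inl (.inl i)) ∈ side w}
  replace hu : ρ < (P u).ncard := by simpa only [P, hmem, Function.comp_apply] using hu
  replace hv : ρ < (P v).ncard := by simpa only [P, hmem, Function.comp_apply] using hv
  by_cases hcase : ∀ j ∈ P v, ∃ i ∈ P u, φ (.inl (.inr (i, j))) ∈ side u
  · have hc (j) : ∃ i, j ∈ P v → i ∈ P u ∧ φ (.inl (.inr (i, j))) ∈ side u := by
      by_cases hj : j ∈ P v
      · obtain ⟨i, hi⟩ := hcase j hj
        exact ⟨i, fun _ ↦ hi⟩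
      · exact ⟨j, fun h ↦ (hj h).elim⟩
    choose c hc using hc
    exact hv.not_ge (ncard_le_of_simClassesLE φ (hsub u) hclu (P v) c (fun j ↦ (c j, j))
      (fun _ ↦ Or.inl rfl) (fun j hj ↦ hdisj' _ hj) (fun j hj ↦ (hc j hj).1)
      (fun j hj ↦ (hc j hj).2))
  · push Not at hcase
    obtain ⟨j, hj, hji⟩ := hcase
    exact hu.not_ge (ncard_le_of_simClassesLE φ (hsub v) hclv (P u) (fun _ ↦ j) (fun i ↦ (i, j))
      (fun _ ↦ Or.inr rfl) (fun i hi ↦ hdisj _ hi) (fun _ _ ↦ hj)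
      (fun i hi ↦ (hcover _).resolve_left (hji i hi)))

end lineMatroid

/-- the class of transversal matroids is not pigeonhole. -/
theorem transversal_not_pigeonhole {α : Type*} [Infinite α] :
    ∃ l : ℕ, 0 < l ∧ ∀ ρ : ℕ, ∃ M : Matroid α,
      Transversal M ∧ bwLE M l ∧ ¬ dwLE M ρ := by
  refine ⟨4, by norm_num, fun ρ ↦ ?_⟩
  let φ : (Fin (3 * ρ + 2) ⊕ Fin (3 * ρ + 2) × Fin (3 * ρ + 2)) ⊕ Fin 3 ↪ α :=
    (Finite.equivFin _).toEmbedding.trans (Fin.valEmbedding.trans (Infinite.natEmbedding α))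
  exact ⟨lineMatroid φ, transversal_lineMatroid φ, bwLE_lineMatroid φ,
    not_dwLE_lineMatroid φ (by omega)⟩
end

section
/- Let G be a finite simple graph, let H be a group, and let σ be a gain function on G. Let X be a set of edges of G such that every cycle of the subgraph G[X] has gain value equal to the identity of H. If u and v are distinct vertices of G[X] and P and P' are paths in G[X] from u to v, then σ(P) = σ(P'). -/
open Set

/-- The list `l` of vertices is a walk using edges of the edge set `X`. -/
def chainEdges {α : Type*} (X : Set (Sym2 α)) (l : List α) : Prop :=
  List.Chain' (fun x y => s(x, y) ∈ X) l

/-- The gain value of the walk given by the vertex list `l`: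
σ(v₀,v₁)σ(v₁,v₂)⋯σ(v_{t−1},v_t). -/
def gainOf {α H : Type*} [Group H] (σ : α → α → H) (l : List α) : H :=
  (List.zipWith σ l l.tail).prod

section Gain

variable {α H : Type*} [Group H]

theorem gainOf_append_cons (σ : α → α → H) (l m : List α) (x : α) :
    gainOf σ (l ++ x :: m) = gainOf σ (l ++ [x]) * gainOf σ (x :: m) := by
  induction l with
  | nil => simp [gainOf]
  | cons a l ih => cases l <;> simp_all [gainOf, mul_assoc]

theorem chainEdges_append_cons {X : Set (Sym2 α)} {l m : List α} {x : α} :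
    chainEdges X (l ++ x :: m) ↔ chainEdges X (l ++ [x]) ∧ chainEdges X (x :: m) :=
  List.isChain_split

theorem chainEdges.reverse {X : Set (Sym2 α)} {l : List α} (h : chainEdges X l) :
    chainEdges X l.reverse :=
  List.isChain_reverse.2 (List.IsChain.imp (fun x y hxy => by rwa [Sym2.eq_swap]) h)

theorem gainOf_reverse {σ : α → α → H} {X : Set (Sym2 α)}
    (hσ : ∀ x y, s(x, y) ∈ X → σ y x = (σ x y)⁻¹) {l : List α} (h : chainEdges X l) :
    gainOf σ l.reverse = (gainOf σ l)⁻¹ := by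
  induction l with
  | nil => simp [gainOf]
  | cons a l ih =>
    cases l with
    | nil => simp [gainOf]
    | cons b l =>
      obtain ⟨hab, hl⟩ := List.isChain_cons_cons.1 h
      have hrev := ih hl
      have hcons : gainOf σ (a :: b :: l) = σ a b * gainOf σ (b :: l) := by simp [gainOf]
      rw [List.reverse_cons] at hrev
      rw [List.reverse_cons, List.reverse_cons, List.append_assoc, List.singleton_append,
        gainOf_append_cons, hrev, hcons, mul_inv_rev]
      simp [gainOf, hσ a b hab]

theorem List.exists_eq_append_of_not_nodup {l : List α} (h : ¬ l.Nodup) :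
    ∃ l₁ x l₂ l₃, l = l₁ ++ x :: (l₂ ++ x :: l₃) := by
  induction l with
  | nil => simp at h
  | cons a l ih =>
    by_cases ha : a ∈ l
    · obtain ⟨s, t, rfl⟩ := List.append_of_mem ha
      exact ⟨[], a, s, t, rfl⟩
    · obtain ⟨l₁, x, l₂, l₃, rfl⟩ := ih fun hl => h (List.nodup_cons.2 ⟨ha, hl⟩)
      exact ⟨a :: l₁, x, l₂, l₃, rfl⟩

/-- If every cycle of `G[X]` has trivial gain, then so does every closed walk. -/
theorem gainOf_closed_walk {σ : α → α → H} {X : Set (Sym2 α)}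
    (hσ : ∀ x y, s(x, y) ∈ X → σ y x = (σ x y)⁻¹) (hloop : ∀ x, s(x, x) ∉ X)
    (hbal : ∀ (l : List α) (x₀ xl : α), 3 ≤ l.length → l.Nodup →
      l.head? = some x₀ → l.getLast? = some xl →
      chainEdges X l → s(xl, x₀) ∈ X → gainOf σ (l ++ [x₀]) = 1)
    (a : α) (m : List α) (h : chainEdges X (a :: (m ++ [a]))) :
    gainOf σ (a :: (m ++ [a])) = 1 := by
  induction hn : m.length using Nat.strong_induction_on generalizing a m with
  | _ n ih =>
  subst hn
  by_cases ha : a ∈ m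
  · obtain ⟨s, t, rfl⟩ := List.append_of_mem ha
    have heq : a :: (s ++ a :: t ++ [a]) = (a :: s) ++ a :: (t ++ [a]) := by simp
    rw [heq] at h ⊢
    obtain ⟨hs, ht⟩ := chainEdges_append_cons.1 h
    rw [gainOf_append_cons, ih t.length (by simp; omega) a t ht rfl, mul_one]
    exact ih s.length (by simp) a s hs rfl
  by_cases hm : m.Nodup
  · rcases m.eq_nil_or_concat with rfl | ⟨m, b, rfl⟩
    · exact absurd (List.isChain_cons_cons.1 h).1 (hloop a)
    · have heq : a :: (m ++ [b] ++ [a]) = (a :: m) ++ b :: [a] := by simp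
      have hsplit := h
      rw [List.concat_eq_append, heq] at hsplit
      obtain ⟨hpath, hlast⟩ := chainEdges_append_cons.1 hsplit
      have hba : s(b, a) ∈ X := (List.isChain_cons_cons.1 hlast).1
      cases m with
      | nil => simp [gainOf, hσ b a hba]
      | cons c m =>
        exact hbal (a :: (c :: m).concat b) a b (by simp) (List.nodup_cons.2 ⟨ha, hm⟩)
          rfl (by simp [List.getLast?_cons]) (by simpa using hpath) hba
  · obtain ⟨l₁, x, l₂, l₃, rfl⟩ := List.exists_eq_append_of_not_nodup hm
    have heq : a :: (l₁ ++ x :: (l₂ ++ x :: l₃) ++ [a])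
        = (a :: l₁) ++ x :: (l₂ ++ x :: (l₃ ++ [a])) := by simp
    have heq' : (a :: l₁) ++ x :: (l₃ ++ [a]) = a :: ((l₁ ++ x :: l₃) ++ [a]) := by simp
    rw [heq] at h ⊢
    obtain ⟨h₁, h₂⟩ := chainEdges_append_cons.1 h
    rw [← List.cons_append] at h₂
    obtain ⟨h₂, h₃⟩ := chainEdges_append_cons.1 h₂
    have hshort := chainEdges_append_cons.2 ⟨h₁, h₃⟩
    rw [heq'] at hshort
    rw [gainOf_append_cons, ← List.cons_append (a := x) (as := l₂), gainOf_append_cons σ (x :: l₂),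
      List.cons_append (a := x), ih l₂.length (by simp; omega) x l₂ h₂ rfl, one_mul,
      ← gainOf_append_cons, heq']
    exact ih _ (by simp) a (l₁ ++ x :: l₃) hshort rfl

end Gain

/-- if every cycle of G[X] has gain value the identity, then any two paths
in G[X] between the same pair of distinct vertices have the same gain value. -/
theorem gain_path_unique {α H : Type*} [Group H] (G : SimpleGraph α)
    (σ : α → α → H) (hσ : ∀ x y, G.Adj x y → σ y x = (σ x y)⁻¹)
    (X : Set (Sym2 α)) (hX : X ⊆ G.edgeSet)
    (hbal : ∀ (l : List α) (x₀ xl : α), 3 ≤ l.length → l.Nodup →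
      l.head? = some x₀ → l.getLast? = some xl →
      chainEdges X l → s(xl, x₀) ∈ X → gainOf σ (l ++ [x₀]) = 1)
    (u v : α) (huv : u ≠ v)
    (hu : ∃ e ∈ X, u ∈ e) (hv : ∃ e ∈ X, v ∈ e)
    (p p' : List α)
    (hp : p.Nodup ∧ p.head? = some u ∧ p.getLast? = some v ∧ chainEdges X p)
    (hp' : p'.Nodup ∧ p'.head? = some u ∧ p'.getLast? = some v ∧ chainEdges X p') :
    gainOf σ p = gainOf σ p' := by
  obtain ⟨-, hpu, hpv, hpX⟩ := hp
  obtain ⟨-, hpu', hpv', hpX'⟩ := hp'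
  have hσX : ∀ x y, s(x, y) ∈ X → σ y x = (σ x y)⁻¹ := fun x y h => hσ x y (hX h)
  obtain ⟨s, rfl⟩ := List.getLast?_eq_some_iff.1 hpv
  obtain ⟨s', rfl⟩ := List.getLast?_eq_some_iff.1 hpv'
  have hrev := gainOf_reverse hσX hpX'
  have hrevX := hpX'.reverse
  rw [List.reverse_append, List.reverse_singleton, List.singleton_append] at hrev hrevX
  have hclosed := chainEdges_append_cons.2 ⟨hpX, hrevX⟩
  have hgain := gainOf_append_cons σ s s'.reverse v
  rw [hrev] at hgain
  rw [← mul_inv_eq_one, ← hgain]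
  cases s with
  | nil => exact absurd (by simpa using hpu.symm) huv
  | cons a s =>
  cases s' with
  | nil => exact absurd (by simpa using hpu'.symm) huv
  | cons b s' =>
  obtain rfl : a = u := by simpa using hpu
  obtain rfl : b = a := by simpa using hpu'
  have heq : (b :: s) ++ v :: (b :: s').reverse = b :: ((s ++ v :: s'.reverse) ++ [b]) := by simp
  rw [heq] at hclosed ⊢
  exact gainOf_closed_walk hσX (fun x h => G.loopless.irrefl x (hX h)) hbal b _ hclosed
end

section
/- Let H be an infinite group. For every positive integer K there exist a positive integer q and elements a_1, …, a_q, b_1, …, b_q of H such that: the sets A = {a_1, …, a_q}, B = {b_1, …, b_q}, and AB = {a_i b_j : 1 ≤ i, j ≤ q} are pairwise disjoint; |A| = |B| = q; the q² products a_i b_j are pairwise distinct; and the rank-3 matroid M on ground set A ∪ B ∪ AB — whose independent sets are exactly the sets of at most 3 elements other than the 3-element subsets of A, the 3-element subsets of B, the 3-element subsets of AB, and the triples {a_i, b_j, a_i b_j} — has decomposition-width greater than K. -/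
open Set

theorem SimpleGraph.Connected.reachable_deleteEdges_or_s19 {V : Type*} {T : SimpleGraph V}
    (hT : T.Connected) (u v x : V) :
    (T.deleteEdges {s(u, v)}).Reachable x u ∨ (T.deleteEdges {s(u, v)}).Reachable x v := by
  obtain ⟨p⟩ := hT.preconnected x v
  induction p with
  | nil => exact Or.inr .rfl
  | @cons x y z h p ih =>
    by_cases he : s(x, y) = s(u, z)
    · rcases Sym2.eq_iff.1 he with ⟨rfl, -⟩ | ⟨rfl, -⟩
      · exact Or.inl .rfl
      · exact Or.inr .rfl
    · have hxy : (T.deleteEdges {s(u, z)}).Reachable x y :=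
        (SimpleGraph.deleteEdges_adj.2 ⟨h, he⟩).reachable
      exact ih.imp hxy.trans hxy.trans

theorem SimpleGraph.Connected.exists_adj_reachable_deleteEdges_s19 {V : Type*} {T : SimpleGraph V}
    (hT : T.Connected) {v x : V} (hvx : v ≠ x) :
    ∃ w, T.Adj v w ∧ (T.deleteEdges {s(v, w)}).Reachable x w := by
  obtain ⟨p, hp⟩ := (hT.preconnected v x).exists_isPath
  cases p with
  | nil => exact absurd rfl hvx
  | @cons _ w _ h p =>
    rw [SimpleGraph.Walk.cons_isPath_iff] at hp
    refine ⟨w, h, SimpleGraph.Reachable.symm ?_⟩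
    rw [SimpleGraph.reachable_deleteEdges_iff_exists_walk]
    exact ⟨p, fun he => hp.2 (p.fst_mem_support_of_mem_edges he)⟩

/-- If more than `3 * K + 1` vertices are marked in a finite tree of maximum degree at most three,
then some edge has more than `K` marked vertices on both sides. -/
theorem SimpleGraph.IsTree.exists_balanced_edge_s19 {V ι : Type*} [Finite V] [Fintype ι]
    {T : SimpleGraph V} (hT : T.IsTree) (hdeg : ∀ v, (T.neighborSet v).ncard ≤ 3)
    {leaf : ι → V} (hleaf : Function.Injective leaf) {K : ℕ}
    (hK : 3 * K + 1 < Fintype.card ι) :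
    ∃ u v, T.Adj u v ∧ K < {i | (T.deleteEdges {s(u, v)}).Reachable (leaf i) u}.ncard ∧
      K < {i | (T.deleteEdges {s(u, v)}).Reachable (leaf i) v}.ncard := by
  classical
  have : Fintype V := Fintype.ofFinite V
  have key : ∀ v, ∃ w, T.Adj v w ∧
      K < {i | (T.deleteEdges {s(v, w)}).Reachable (leaf i) w}.ncard := by
    intro v
    by_contra! hsmall
    set S : V → Finset ι :=
      fun w => Finset.univ.filter fun i => (T.deleteEdges {s(v, w)}).Reachable (leaf i) w with hS
    have hcover : (Finset.univ : Finset ι) ⊆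
        (Finset.univ.filter fun i => leaf i = v) ∪ (T.neighborFinset v).biUnion S := by
      intro i _
      by_cases hi : leaf i = v
      · simp [hi]
      · obtain ⟨w, hw, hr⟩ := hT.connected.exists_adj_reachable_deleteEdges_s19 (Ne.symm hi)
        exact Finset.mem_union_right _
          (Finset.mem_biUnion.2 ⟨w, by simpa using hw, by simp [hS, hr]⟩)
    have hself : (Finset.univ.filter fun i => leaf i = v).card ≤ 1 :=
      Finset.card_le_one.2 fun i hi j hj => hleaf (by simp_all)
    have hbi : ((T.neighborFinset v).biUnion S).card ≤ (T.neighborFinset v).card * K := by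
      refine Finset.card_biUnion_le_card_mul _ _ _ fun w hw => ?_
      have := hsmall w (by simpa using hw)
      rwa [Set.ncard_eq_toFinset_card', Set.toFinset_ofPred] at this
    have hN : (T.neighborFinset v).card ≤ 3 := by
      have := hdeg v
      rwa [Set.ncard_eq_toFinset_card'] at this
    have h1 := (Finset.card_le_card hcover).trans (Finset.card_union_le _ _)
    rw [Finset.card_univ] at h1
    have h2 := Nat.mul_le_mul_right K hN
    omega
  choose g hg hbig using key
  have hlt : T.edgeFinset.card < (Finset.univ : Finset V).card := by
    rw [Finset.card_univ, ← hT.card_edgeFinset]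
    exact Nat.lt_succ_self _
  obtain ⟨v, -, w, -, hvw, he⟩ := Finset.exists_ne_map_eq_of_card_lt_of_maps_to hlt
    (f := fun v => s(v, g v)) (fun v _ => by simpa using hg v)
  rcases Sym2.eq_iff.1 he with ⟨h, -⟩ | ⟨h, h'⟩
  · exact absurd h hvw
  · refine ⟨v, w, h' ▸ hg v, ?_, h' ▸ hbig v⟩
    have := hbig w
    rwa [← h, Sym2.eq_swap] at this

/-- The rank-three matroid on a finite set `E` whose long lines are the members of `L`. -/
theorem exists_matroid_of_lines {α : Type*} {E : Set α} (hE : E.Finite) (L : Set (Set α))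
    (hL : ∀ l ∈ L, ∀ m ∈ L, ∀ x y, x ≠ y → x ∈ l → y ∈ l → x ∈ m → y ∈ m → l = m) :
    ∃ M : Matroid α, M.E = E ∧
      ∀ X ⊆ E, (M.Indep X ↔ X.ncard ≤ 3 ∧ ∀ l ∈ L, ¬ (X ⊆ l ∧ X.ncard = 3)) := by
  refine ⟨(IndepMatroid.ofFinite hE
    (fun X => X ⊆ E ∧ X.ncard ≤ 3 ∧ ∀ l ∈ L, ¬ (X ⊆ l ∧ X.ncard = 3)) ?_ ?_ ?_ ?_).matroid,
    rfl, fun X hX => ?_⟩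
  · simp
  · rintro I J ⟨hJE, hJ, hJL⟩ hIJ
    have hfin := hE.subset hJE
    have hle := Set.ncard_le_ncard hIJ hfin
    refine ⟨hIJ.trans hJE, hle.trans hJ, fun l hl h => ?_⟩
    have : I = J := Set.eq_of_subset_of_ncard_le hIJ (by omega) hfin
    exact hJL l hl (this ▸ h)
  · rintro I J ⟨hIE, hI, hIL⟩ ⟨hJE, hJ, hJL⟩ hlt
    have hIfin := hE.subset hIE
    by_contra! hno
    have hins : ∀ e ∈ J, e ∉ I → ∃ l ∈ L, insert e I ⊆ l ∧ (insert e I).ncard = 3 := by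
      intro e he heI
      have hcard := Set.ncard_insert_of_notMem heI hIfin
      exact hno e he heI (Set.insert_subset (hJE he) hIE) (by omega)
    obtain ⟨e, he, heI⟩ := Set.exists_mem_notMem_of_ncard_lt_ncard hlt hIfin
    obtain ⟨l, hl, hsub, hcard⟩ := hins e he heI
    rw [Set.ncard_insert_of_notMem heI hIfin] at hcard
    obtain ⟨x, y, hxy, rfl⟩ := Set.ncard_eq_two.1 (by omega : I.ncard = 2)
    refine hJL l hl ⟨fun f hf => ?_, by omega⟩
    by_cases hfI : f ∈ ({x, y} : Set α)
    · exact hsub (Set.mem_insert_of_mem _ hfI)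
    · obtain ⟨m, hm, hsub', -⟩ := hins f hf hfI
      rw [hL l hl m hm x y hxy (hsub (by simp)) (hsub (by simp)) (hsub' (by simp))
        (hsub' (by simp))]
      exact hsub' (by simp)
  · exact fun I h => h.1
  · simp [hX]

/-- An infinite group contains two families of any given size, disjoint from each other and from
their pairwise products, which are all distinct. -/
theorem exists_families_with_distinct_products (H : Type*) [Group H] [Infinite H] (q : ℕ) :
    ∃ a b : Fin q → H, Function.Injective a ∧ Function.Injective b ∧
      (∀ i j k l, a i * b j = a k * b l → i = k ∧ j = l) ∧
      (∀ i j, a i ≠ b j) ∧ (∀ k i j, a k ≠ a i * b j) ∧ (∀ k i j, b k ≠ a i * b j) := by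
  classical
  obtain ⟨A, hA1, hAq⟩ := Infinite.exists_superset_card_eq ({1} : Finset H) (q + 1) (by simp)
  have hAe : (A.erase 1).card = q := by
    rw [Finset.card_erase_of_mem (hA1 (by simp)), hAq, Nat.add_sub_cancel]
  set a : Fin q → H := fun i => ((A.erase 1).equivFinOfCardEq hAe).symm i
  have ha_inj : Function.Injective a :=
    Subtype.val_injective.comp (Equiv.injective _)
  have ha_mem : ∀ i, a i ∈ A.erase 1 := fun i => Subtype.coe_prop _
  have ha_one : ∀ i, a i ≠ 1 := fun i => Finset.ne_of_mem_erase (ha_mem i)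
  have haA : ∀ i, a i ∈ A := fun i => Finset.mem_of_mem_erase (ha_mem i)
  have hone : (1 : H) ∈ A := hA1 (by simp)
  set F : Finset H := Finset.image₂ (fun x y => x⁻¹ * y) A A
  have hFmem : ∀ {x y}, x ∈ A → y ∈ A → x⁻¹ * y ∈ F := fun hx hy =>
    Finset.mem_image₂_of_mem hx hy
  have hFA : ∀ {x}, x ∈ A → x ∈ F := fun hx => by simpa using hFmem hone hx
  have hFinv : ∀ {x}, x ∈ F → x⁻¹ ∈ F := by
    intro x hx
    obtain ⟨y, hy, z, hz, rfl⟩ := Finset.mem_image₂.1 hx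
    simpa using hFmem hz hy
  have : Std.Symm (fun x y : H => y * x⁻¹ ∉ F) :=
    ⟨fun x y h h' => h (by simpa using hFinv h')⟩
  obtain ⟨b, hbF, hb⟩ := exists_seq_of_forall_finset_exists' (fun x : H => x ∉ F)
    (fun x y : H => y * x⁻¹ ∉ F) (fun s _ => by
      obtain ⟨y, hy⟩ := Infinite.exists_notMem_finset
        (F ∪ Finset.image₂ (fun f x => f * x) F s)
      rw [Finset.notMem_union] at hy
      refine ⟨y, hy.1, fun x hx hyx => hy.2 ?_⟩
      exact Finset.mem_image₂.2 ⟨_, hyx, x, hx, by simp⟩)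
  have hb' : ∀ m n, b m * (b n)⁻¹ ∈ F → m = n := fun m n h => by
    by_contra hmn
    exact hb (Ne.symm hmn) h
  refine ⟨a, fun j => b j, ha_inj, fun i j hij => ?_, fun i j k l h => ?_, fun i j h => ?_,
    fun k i j h => ?_, fun k i j h => ?_⟩
  · exact Fin.ext (hb' _ _ (by simpa [show b i = b j from hij] using hFA hone))
  · have hjl : j = l := by
      refine Fin.ext (hb' _ _ ?_)
      have : b j * (b l)⁻¹ = (a i)⁻¹ * a k := by
        rw [mul_inv_eq_iff_eq_mul, mul_assoc, ← h, inv_mul_cancel_left]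
      exact this ▸ hFmem (haA i) (haA k)
    subst hjl
    exact ⟨ha_inj (mul_right_cancel h), rfl⟩
  · exact hbF j ((show a i = b j from h) ▸ hFA (haA i))
  · have hbj : b j = (a i)⁻¹ * a k := eq_inv_mul_of_mul_eq h.symm
    exact hbF j (hbj ▸ hFmem (haA i) (haA k))
  · have hkj : (k : ℕ) = j := hb' _ _ (by
      rw [mul_inv_eq_of_eq_mul h]
      exact hFA (haA i))
    refine ha_one i ?_
    simpa [hkj] using h

theorem SimClassesLE.ncard_le {α ι : Type*} {M : Matroid α} {U : Set α} {k : ℕ}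
    (h : SimClassesLE M U k) (I : Set ι) (X : ι → Set α) (hX : ∀ i ∈ I, X i ⊆ U)
    (hsep : ∀ i ∈ I, ∀ j ∈ I, Sim M U (X i) (X j) → i = j) : I.ncard ≤ k := by
  obtain ⟨f, hf⟩ := h
  have := Set.ncard_le_ncard_of_injOn (s := I) (t := Set.univ) (fun i => f (X i))
    (fun _ _ => Set.mem_univ _)
    (fun i hi j hj hij => hsep i hi j hj (hf _ _ (hX i hi) (hX j hj) hij)) Set.finite_univ
  simpa [Set.ncard_univ] using this

/-- The matroid on `A ∪ B ∪ AB` has no displayed bipartition with few classes on both sides, many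
elements of `A` on one side and many elements of `B` on the other. -/
theorem ncard_le_or_of_simClassesLE {H ι : Type*} [Mul H] {M : Matroid H} {a b : ι → H}
    (haE : ∀ i, a i ∈ M.E) (hbE : ∀ j, b j ∈ M.E) (habE : ∀ i j, a i * b j ∈ M.E)
    (hM : ∀ i k j l, M.Indep {a k, b l, a i * b j} ↔ ¬ (i = k ∧ j = l)) {K : ℕ} {U W : Set H}
    (hdisj : Disjoint U W) (hcover : M.E ⊆ U ∪ W) (hU : SimClassesLE M U K)
    (hW : SimClassesLE M W K) :
    {i | a i ∈ W}.ncard ≤ K ∨ {j | b j ∈ U}.ncard ≤ K := by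
  by_cases h : ∀ i, ∃ j, a i ∈ W → b j ∈ U ∧ a i * b j ∈ U
  · left
    choose g hg using h
    refine hU.ncard_le _ (fun i => {b (g i), a i * b (g i)})
      (fun i hi => by simpa [Set.insert_subset_iff] using hg i hi) fun i hi k hk hs => ?_
    have := hs {a i} (by simpa using ⟨haE i, hdisj.notMem_of_mem_right hi⟩)
    simp only [Set.union_singleton, hM] at this
    tauto
  · right
    push Not at h
    obtain ⟨i, hi⟩ := h
    refine hW.ncard_le _ (fun j => {a i, a i * b j}) (fun j hj => ?_) fun j hj l hl hs => ?_
    · have := (hcover (habE i j)).resolve_left ((hi j).2 hj)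
      simpa [Set.insert_subset_iff] using ⟨(hi j).1, this⟩
    · have := hs {b j} (by simpa using ⟨hbE j, hdisj.notMem_of_mem_left hj⟩)
      simp only [Set.union_singleton, Set.insert_comm (b j) (a i), hM] at this
      tauto

theorem not_dwLE_of_indep_iff {H : Type*} [Mul H] {M : Matroid H} {K q : ℕ} (hq : 3 * K + 1 < q)
    {a b : Fin q → H} (ha : Function.Injective a)
    (haE : ∀ i, a i ∈ M.E) (hbE : ∀ j, b j ∈ M.E) (habE : ∀ i j, a i * b j ∈ M.E)
    (hM : ∀ i k j l, M.Indep {a k, b l, a i * b j} ↔ ¬ (i = k ∧ j = l)) : ¬ dwLE M K := by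
  rintro ⟨D, hD⟩
  have := D.fin
  set leaf : M.E → D.V := fun x => (D.leafEquiv x).1
  have hleaf_inj : Function.Injective leaf :=
    Subtype.val_injective.comp D.leafEquiv.injective
  obtain ⟨u, v, huv, hu, hv⟩ := SimpleGraph.IsTree.exists_balanced_edge_s19 (T := D.T)
    ⟨D.conn, D.acyc⟩ (fun v => by have := D.deg v; omega)
    (leaf := fun i => leaf ⟨a i, haE i⟩)
    (fun i j hij => ha (Subtype.ext_iff.1 (hleaf_inj hij))) (K := K) (by simpa using hq)
  set side : D.V → Set H := fun w =>
    {x | ∃ h : x ∈ M.E, (D.T.deleteEdges {s(u, v)}).Reachable (leaf ⟨x, h⟩) w} with hside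
  have hU : SimClassesLE M (side u) K := hD _ ⟨u, v, huv, rfl⟩
  have hW : SimClassesLE M (side v) K :=
    hD _ ⟨v, u, huv.symm, by simp only [hside, Sym2.eq_swap (a := v)]; rfl⟩
  have hdisj : Disjoint (side u) (side v) := by
    rw [Set.disjoint_left]
    rintro x ⟨h, hxu⟩ ⟨_, hxv⟩
    exact SimpleGraph.isAcyclic_iff_forall_adj_isBridge.1 D.acyc huv (hxu.symm.trans hxv)
  have hcover : M.E ⊆ side u ∪ side v := fun x hx =>
    (D.conn.reachable_deleteEdges_or_s19 u v (leaf ⟨x, hx⟩)).imp (⟨hx, ·⟩) (⟨hx, ·⟩)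
  have hmem : ∀ w i, a i ∈ side w ↔
      (D.T.deleteEdges {s(u, v)}).Reachable (leaf ⟨a i, haE i⟩) w :=
    fun w i => ⟨fun ⟨_, h⟩ => h, fun h => ⟨haE i, h⟩⟩
  simp only [← hmem] at hu hv
  have hBU := (ncard_le_or_of_simClassesLE haE hbE habE hM hdisj hcover hU hW).resolve_left
    (not_le.2 hv)
  have hBW := (ncard_le_or_of_simClassesLE haE hbE habE hM hdisj.symm
    (Set.union_comm _ _ ▸ hcover) hW hU).resolve_left (not_le.2 hu)
  have hunion : {j | b j ∈ side u} ∪ {j | b j ∈ side v} = Set.univ :=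
    Set.eq_univ_of_forall fun j => hcover (hbE j)
  have := Set.ncard_union_le {j | b j ∈ side u} {j | b j ∈ side v}
  rw [hunion, Set.ncard_univ, Nat.card_fin] at this
  omega

/-- for an infinite group H and every K there is a rank-3 H-gain-graphic
matroid (on ground set A ∪ B ∪ AB built from products in H) of decomposition-width
greater than K. -/
theorem infinite_group_gain_matroid_dw {H : Type*} [Group H] [Infinite H]
    (K : ℕ) (hK : 0 < K) :
    ∃ (q : ℕ) (a b : Fin q → H), 0 < q ∧
      Function.Injective a ∧ Function.Injective b ∧
      (∀ i j k l : Fin q, a i * b j = a k * b l → i = k ∧ j = l) ∧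
      (Set.range a ∩ Set.range b = ∅) ∧
      (Set.range a ∩ {x | ∃ i j, x = a i * b j} = ∅) ∧
      (Set.range b ∩ {x | ∃ i j, x = a i * b j} = ∅) ∧
      ∃ M : Matroid H,
        M.E = Set.range a ∪ Set.range b ∪ {x | ∃ i j, x = a i * b j} ∧
        (∀ X ⊆ M.E, (M.Indep X ↔ (X.ncard ≤ 3 ∧
          ¬(X ⊆ Set.range a ∧ X.ncard = 3) ∧
          ¬(X ⊆ Set.range b ∧ X.ncard = 3) ∧
          ¬(X ⊆ {x | ∃ i j, x = a i * b j} ∧ X.ncard = 3) ∧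
          ¬∃ i j, X = {a i, b j, a i * b j}))) ∧
        ¬ dwLE M K := by
  obtain ⟨a, b, ha, hb, hab, hAB, hAP, hBP⟩ := exists_families_with_distinct_products H (3 * K + 2)
  set A := Set.range a
  set B := Set.range b
  set P := {x | ∃ i j, x = a i * b j}
  have hdAB : ∀ x, x ∈ A → x ∈ B → False := by
    rintro _ ⟨i, rfl⟩ ⟨j, h⟩
    exact hAB i j h.symm
  have hdAP : ∀ x, x ∈ A → x ∈ P → False := by
    rintro _ ⟨k, rfl⟩ ⟨i, j, h⟩
    exact hAP k i j h
  have hdBP : ∀ x, x ∈ B → x ∈ P → False := by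
    rintro _ ⟨k, rfl⟩ ⟨i, j, h⟩
    exact hBP k i j h
  have haA : ∀ i, a i ∈ A := fun i => ⟨i, rfl⟩
  have hbB : ∀ j, b j ∈ B := fun j => ⟨j, rfl⟩
  have habP : ∀ i j, a i * b j ∈ P := fun i j => ⟨i, j, rfl⟩
  have hcard : ∀ i k j l, ({a k, b l, a i * b j} : Set H).ncard = 3 := fun i k j l =>
    Set.ncard_eq_three.2 ⟨_, _, _, hAB k l, hAP k i j, hBP l i j, rfl⟩
  have hPfin : P.Finite :=
    (Set.finite_range fun p : Fin (3 * K + 2) × Fin (3 * K + 2) => a p.1 * b p.2).subset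
      (by rintro _ ⟨i, j, rfl⟩; exact ⟨(i, j), rfl⟩)
  obtain ⟨M, hME, hM⟩ := exists_matroid_of_lines
    (((Set.finite_range a).union (Set.finite_range b)).union hPfin)
    ({A, B, P} ∪ {l | ∃ i j, l = {a i, b j, a i * b j}}) (by
      have htriple : ∀ l ∈ ({A, B, P} : Set (Set H)), ∀ i j x y, x ≠ y → x ∈ l → y ∈ l →
          x ∈ ({a i, b j, a i * b j} : Set H) → y ∈ ({a i, b j, a i * b j} : Set H) → False := by
        intro l hl i j x y hxy hx hy hx' hy'
        have := haA i
        have := hbB j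
        have := habP i j
        simp only [Set.mem_insert_iff, Set.mem_singleton_iff] at hl hx' hy'
        grind
      rintro l (hl | ⟨i, j, rfl⟩) m (hm | ⟨k, n, rfl⟩) x y hxy hxl hyl hxm hym
      · simp only [Set.mem_insert_iff, Set.mem_singleton_iff] at hl hm
        grind
      · exact (htriple l hl k n x y hxy hxl hyl hxm hym).elim
      · exact (htriple m hm i j x y hxy hxm hym hxl hyl).elim
      · have h : i = k ∧ j = n := by
          simp only [Set.mem_insert_iff, Set.mem_singleton_iff] at hxl hyl hxm hym
          grind [Function.Injective]
        rw [h.1, h.2])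
  rw [← hME] at hM
  have hE : ∀ X ⊆ M.E, (M.Indep X ↔ (X.ncard ≤ 3 ∧ ¬(X ⊆ A ∧ X.ncard = 3) ∧
      ¬(X ⊆ B ∧ X.ncard = 3) ∧ ¬(X ⊆ P ∧ X.ncard = 3) ∧
      ¬∃ i j, X = {a i, b j, a i * b j})) := by
    intro X hX
    have htr : (∃ i j, X = {a i, b j, a i * b j}) ↔
        ∃ i j, X ⊆ {a i, b j, a i * b j} ∧ X.ncard = 3 :=
      exists₂_congr fun i j => ⟨by rintro rfl; exact ⟨subset_rfl, hcard i i j j⟩, fun h =>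
        Set.eq_of_subset_of_ncard_le h.1 (by rw [h.2, hcard]) (Set.toFinite _)⟩
    rw [hM X hX, htr]
    constructor
    · rintro ⟨h, hl⟩
      refine ⟨h, hl A (by simp), hl B (by simp), hl P (by simp), ?_⟩
      rintro ⟨i, j, hij⟩
      exact hl _ (Or.inr ⟨i, j, rfl⟩) hij
    · rintro ⟨h, h1, h2, h3, h4⟩
      refine ⟨h, ?_⟩
      rintro l ((rfl | rfl | rfl) | ⟨i, j, rfl⟩)
      exacts [h1, h2, h3, fun h => h4 ⟨i, j, h⟩]
  have haE : ∀ i, a i ∈ M.E := fun i => hME ▸ Or.inl (Or.inl (haA i))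
  have hbE : ∀ j, b j ∈ M.E := fun j => hME ▸ Or.inl (Or.inr (hbB j))
  have habE : ∀ i j, a i * b j ∈ M.E := fun i j => hME ▸ Or.inr (habP i j)
  refine ⟨3 * K + 2, a, b, by omega, ha, hb, hab,
    Set.eq_empty_of_forall_notMem fun x hx => hdAB x hx.1 hx.2,
    Set.eq_empty_of_forall_notMem fun x hx => hdAP x hx.1 hx.2,
    Set.eq_empty_of_forall_notMem fun x hx => hdBP x hx.1 hx.2, M, hME, hE,
    not_dwLE_of_indep_iff (by omega) ha haE hbE habE fun i k j l => ?_⟩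
  have hsub : ({a k, b l, a i * b j} : Set H) ⊆ M.E := by
    simp [Set.insert_subset_iff, haE, hbE, habE]
  rw [hE _ hsub]
  refine Iff.symm ⟨fun hne => ?_, ?_⟩
  · refine ⟨(hcard i k j l).le, fun h => ?_, fun h => ?_, fun h => ?_, ?_⟩
    · exact hdAB _ (h.1 (by simp)) (hbB l)
    · exact hdAB _ (haA k) (h.1 (by simp))
    · exact hdAP _ (haA k) (h.1 (by simp))
    · rintro ⟨m, n, h⟩
      have hk : a k ∈ ({a m, b n, a m * b n} : Set H) := h ▸ by simp
      have hl : b l ∈ ({a m, b n, a m * b n} : Set H) := h ▸ by simp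
      have hp : a i * b j ∈ ({a m, b n, a m * b n} : Set H) := h ▸ by simp
      simp only [Set.mem_insert_iff, Set.mem_singleton_iff] at hk hl hp
      grind [Function.Injective]
  · rintro ⟨-, -, -, -, h⟩
    exact fun hc => h ⟨i, j, by rw [hc.1, hc.2]⟩
end
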